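/- Let R be a commutative ring and M an R-module. Then M is weak w-projective if and only if for every w-exact sequence 0 → L → E → M → 0 of R-modules and every R-module N in P_w^{†∞}, the induced sequence 0 → Hom_R(M, N) → Hom_R(E, N) → Hom_R(L, N) → 0 is exact. -/

import Mathlib

/-!  Background definitions for the `w`-operation theory of Wang–Kim–Qiao.  -/

open CategoryTheory

section WTheory

variable (R : Type) [CommRing R]

/-- `J` is a Glaz–Vasconcelos ideal: it is finitely generated and the natural map
`R → Hom_R(J, R)`, sending `r` to multiplication by `r`, is bijective. -/
def IsGVIdeal (J : Ideal R) : Prop :=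
  J.FG ∧ Function.Bijective fun r : R => (r • J.subtype : J →ₗ[R] R)

/-- `M` is `GV`-torsion: every element is annihilated by some GV-ideal. -/
def IsGVTorsion (M : Type*) [AddCommGroup M] [Module R M] : Prop :=
  ∀ x : M, ∃ J : Ideal R, IsGVIdeal R J ∧ ∀ j ∈ J, j • x = 0

/-- `M` is `GV`-torsion-free: no nonzero element is annihilated by a GV-ideal. -/
def IsGVTorsionFree (M : Type*) [AddCommGroup M] [Module R M] : Prop :=
  ∀ x : M, (∃ J : Ideal R, IsGVIdeal R J ∧ ∀ j ∈ J, j • x = 0) → x = 0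

/-- `Ext^n_R(M, N)`, as an `R`-module. -/
noncomputable def extM (M N : Type) [AddCommGroup M] [Module R M]
    [AddCommGroup N] [Module R N] (n : ℕ) : ModuleCat R :=
  ((Ext R (ModuleCat R) n).obj (Opposite.op (ModuleCat.of R M))).obj (ModuleCat.of R N)

/-- `M` is a `w`-module: it is GV-torsion-free and `Ext^1_R(R/J, M) = 0`
for every GV-ideal `J`. -/
def IsWModule (M : Type) [AddCommGroup M] [Module R M] : Prop :=
  IsGVTorsionFree R M ∧
    ∀ J : Ideal R, IsGVIdeal R J → Subsingleton (extM R (R ⧸ J) M 1)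

/-- `(L, ι)` is a `w`-envelope of `M`: `L` is a `w`-module, `ι : M → L` is an injective
linear map, and its cokernel is GV-torsion. -/
def IsWEnvelope (M L : Type) [AddCommGroup M] [Module R M] [AddCommGroup L]
    [Module R L] (ι : M →ₗ[R] L) : Prop :=
  IsWModule R L ∧ Function.Injective ι ∧ IsGVTorsion R (L ⧸ LinearMap.range ι)

/-- The GV-torsion submodule `tor_GV(M)`.  (The displayed generating set is already closed
under the module operations, since the GV-ideals form a multiplicative system of ideals,
so the span coincides with the displayed set.) -/
def torGV (M : Type) [AddCommGroup M] [Module R M] : Submodule R M :=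
  Submodule.span R {x : M | ∃ J : Ideal R, IsGVIdeal R J ∧ ∀ j ∈ J, j • x = 0}

/-- `M` is `w`-projective: for every GV-torsion-free `w`-module `N` and every
`w`-envelope `(L, ι)` of `M / tor_GV(M)`, the module `Ext^1_R(L, N)` is GV-torsion. -/
def IsWProjective (M : Type) [AddCommGroup M] [Module R M] : Prop :=
  ∀ (N : Type) [AddCommGroup N] [Module R N], IsGVTorsionFree R N → IsWModule R N →
    ∀ (L : Type) [AddCommGroup L] [Module R L] (ι : (M ⧸ torGV R M) →ₗ[R] L),
      IsWEnvelope R (M ⧸ torGV R M) L ι → IsGVTorsion R (extM R L N 1)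

/-- `N` belongs to the class `P_w^{†∞}`: it is GV-torsion-free and
`Ext^k_R(M, N) = 0` for every `w`-projective `M` and every `k ≥ 1`. -/
def MemPwDaggerInfty (N : Type) [AddCommGroup N] [Module R N] : Prop :=
  IsGVTorsionFree R N ∧
    ∀ (M : Type) [AddCommGroup M] [Module R M], IsWProjective R M →
      ∀ k : ℕ, 1 ≤ k → Subsingleton (extM R M N k)

/-- `M` is weak `w`-projective: `Ext^1_R(M, N) = 0` for every `N ∈ P_w^{†∞}`. -/
def IsWeakWProjective (M : Type) [AddCommGroup M] [Module R M] : Prop :=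
  ∀ (N : Type) [AddCommGroup N] [Module R N], MemPwDaggerInfty R N →
    Subsingleton (extM R M N 1)

end WTheory

section WExactness

variable (R : Type) [CommRing R]

/-- `I` is a `w`-ideal of `R`. -/
def IsWIdeal (I : Ideal R) : Prop :=
  ∀ x : R, (∃ J : Ideal R, IsGVIdeal R J ∧ ∀ j ∈ J, j * x ∈ I) → x ∈ I

/-- `P` is a maximal `w`-ideal: it is maximal among proper `w`-ideals of `R`.
(Every maximal `w`-ideal is a prime ideal.) -/
def IsMaxWIdeal (P : Ideal R) : Prop :=
  IsWIdeal R P ∧ P ≠ ⊤ ∧ ∀ I : Ideal R, IsWIdeal R I → I ≠ ⊤ → P ≤ I → I = P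

/-- The localization of a linear map at a submonoid. -/
noncomputable def locMap (S : Submonoid R) {A B : Type} [AddCommGroup A] [Module R A]
    [AddCommGroup B] [Module R B] (f : A →ₗ[R] B) :
    LocalizedModule S A →ₗ[R] LocalizedModule S B :=
  IsLocalizedModule.map S (LocalizedModule.mkLinearMap S A) (LocalizedModule.mkLinearMap S B) f

/-- `f` is a `w`-monomorphism: its localization at every maximal `w`-ideal is injective. -/
def IsWMono {A B : Type} [AddCommGroup A] [Module R A] [AddCommGroup B] [Module R B]
    (f : A →ₗ[R] B) : Prop :=
  ∀ (P : Ideal R), IsMaxWIdeal R P → ∀ [P.IsPrime],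
    Function.Injective (locMap R P.primeCompl f)

/-- `f` is a `w`-epimorphism: its localization at every maximal `w`-ideal is surjective. -/
def IsWEpi {A B : Type} [AddCommGroup A] [Module R A] [AddCommGroup B] [Module R B]
    (f : A →ₗ[R] B) : Prop :=
  ∀ (P : Ideal R), IsMaxWIdeal R P → ∀ [P.IsPrime],
    Function.Surjective (locMap R P.primeCompl f)

/-- `0 → A → B → C → 0` is a `w`-exact sequence: its localization at every maximal
`w`-ideal is a short exact sequence. -/
def IsWShortExact {A B C : Type} [AddCommGroup A] [Module R A] [AddCommGroup B] [Module R B]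
    [AddCommGroup C] [Module R C] (f : A →ₗ[R] B) (g : B →ₗ[R] C) : Prop :=
  ∀ (P : Ideal R), IsMaxWIdeal R P → ∀ [P.IsPrime],
    Function.Injective (locMap R P.primeCompl f) ∧
    Function.Exact (locMap R P.primeCompl f) (locMap R P.primeCompl g) ∧
    Function.Surjective (locMap R P.primeCompl g)

/-- `M` is of finite type: there is a `w`-epimorphism from a finitely generated free module. -/
def IsFiniteType (M : Type) [AddCommGroup M] [Module R M] : Prop :=
  ∃ (n : ℕ) (g : (Fin n → R) →ₗ[R] M), IsWEpi R g

/-- `M` is of finitely presented type: there is a `w`-exact sequence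
`F₁ → F₀ → M → 0` with `F₁`, `F₀` finitely generated free. -/
def IsFinitelyPresentedType (M : Type) [AddCommGroup M] [Module R M] : Prop :=
  ∃ (m n : ℕ) (f : (Fin m → R) →ₗ[R] (Fin n → R)) (g : (Fin n → R) →ₗ[R] M),
    IsWEpi R g ∧ ∀ (P : Ideal R), IsMaxWIdeal R P → ∀ [P.IsPrime],
      Function.Exact (locMap R P.primeCompl f) (locMap R P.primeCompl g)

/-- `M` is `w`-flat: tensoring with `M` preserves `w`-monomorphisms. -/
def IsWFlat (M : Type) [AddCommGroup M] [Module R M] : Prop :=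
  ∀ (A B : Type) [AddCommGroup A] [Module R A] [AddCommGroup B] [Module R B]
    (f : A →ₗ[R] B), IsWMono R f → IsWMono R (LinearMap.lTensor M f)

end WExactness

section HomExtension

variable {R : Type} [CommRing R]

/-- Homomorphisms to `N` extend along every short exact sequence ending in `X`. -/
def HomExtends (R : Type) [CommRing R] (X N : Type) [AddCommGroup X] [Module R X]
    [AddCommGroup N] [Module R N] : Prop :=
  ∀ (A E : Type) [AddCommGroup A] [Module R A] [AddCommGroup E] [Module R E]
    (i : A →ₗ[R] E) (p : E →ₗ[R] X), Function.Injective i → Function.Exact i p →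
    Function.Surjective p → ∀ k : A →ₗ[R] N, ∃ h : E →ₗ[R] N, h ∘ₗ i = k

lemma exists_comp_eq_of_surjective {A B N : Type*} [AddCommGroup A] [Module R A]
    [AddCommGroup B] [Module R B] [AddCommGroup N] [Module R N] (q : A →ₗ[R] B)
    (hq : Function.Surjective q) (k : A →ₗ[R] N) (hk : ∀ x, q x = 0 → k x = 0) :
    ∃ h : B →ₗ[R] N, h ∘ₗ q = k := by
  refine ⟨(LinearMap.ker q).liftQ k (fun x hx => hk x hx) ∘ₗ
    (q.quotKerEquivOfSurjective hq).symm.toLinearMap, ?_⟩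
  ext x
  have : (q.quotKerEquivOfSurjective hq).symm (q x) = Submodule.Quotient.mk x := by
    rw [LinearEquiv.symm_apply_eq]; rfl
  rw [LinearMap.comp_apply, LinearMap.comp_apply, LinearEquiv.coe_coe, this]
  rfl

/-- It suffices to extend homomorphisms along one projective presentation. -/
lemma HomExtends.of_projective {X N P : Type} [AddCommGroup X] [Module R X]
    [AddCommGroup N] [Module R N] [AddCommGroup P] [Module R P] [Module.Projective R P]
    (π : P →ₗ[R] X) (hπ : Function.Surjective π)
    (H : ∀ k : LinearMap.ker π →ₗ[R] N, ∃ h : P →ₗ[R] N, h ∘ₗ (LinearMap.ker π).subtype = k) :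
    HomExtends R X N := by
  intro A E _ _ _ _ i p hi hip hp k
  obtain ⟨s, hs⟩ := Module.projective_lifting_property p π hp
  have hs' : ∀ y, p (s y) = π y := fun y => LinearMap.congr_fun hs y
  have hmem : ∀ y : LinearMap.ker π, s y ∈ LinearMap.range i := fun y =>
    (hip _).1 (by rw [hs']; exact y.2)
  let e := LinearEquiv.ofInjective i hi
  let t : LinearMap.ker π →ₗ[R] A :=
    e.symm.toLinearMap ∘ₗ (s ∘ₗ (LinearMap.ker π).subtype).codRestrict _ hmem
  have ht : ∀ y, i (t y) = s y := fun y =>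
    congrArg Subtype.val (e.apply_symm_apply ⟨s y, hmem y⟩)
  obtain ⟨e', he'⟩ := H (k ∘ₗ t)
  have he'' : ∀ y : LinearMap.ker π, e' y = k (t y) := fun y => LinearMap.congr_fun he' y
  obtain ⟨h, hh⟩ := exists_comp_eq_of_surjective (i.coprod s)
    (fun x => by
      obtain ⟨y, hy⟩ := hπ (p x)
      obtain ⟨a, ha⟩ := (hip (x - s y)).1 (by rw [map_sub, hs', hy, sub_self])
      exact ⟨(a, y), by simp [ha]⟩)
    (k.coprod e') (fun x hx => by
      obtain ⟨a, y⟩ := x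
      rw [LinearMap.coprod_apply] at hx ⊢
      have hy : π y = 0 := by
        rw [← hs', eq_neg_of_add_eq_zero_right hx, map_neg, hip.apply_apply_eq_zero, neg_zero]
      have ha : t ⟨y, hy⟩ = -a := hi (by
        rw [ht, map_neg]; exact eq_neg_of_add_eq_zero_right hx)
      change k a + e' (⟨y, hy⟩ : LinearMap.ker π) = 0
      rw [he'', ha, map_neg, add_neg_cancel])
  refine ⟨h, LinearMap.ext fun a => ?_⟩
  simpa using LinearMap.congr_fun hh (a, 0)

lemma HomExtends.of_subsingleton {X N : Type} [AddCommGroup X] [Module R X]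
    [AddCommGroup N] [Module R N] [Subsingleton X] : HomExtends R X N := by
  intro A E _ _ _ _ i p hi hip hp k
  let e := LinearEquiv.ofBijective i ⟨hi, fun x => (hip x).1 (Subsingleton.elim _ _)⟩
  exact ⟨k ∘ₗ e.symm.toLinearMap, LinearMap.ext fun a =>
    congrArg k (e.symm_apply_apply a)⟩

/-- Extension along a presentation `P → X` in terms of a longer exact sequence
`B' → B → P → X → 0`. -/
lemma extends_ker_iff_of_exact {X N P B B' : Type} [AddCommGroup X] [Module R X]
    [AddCommGroup N] [Module R N] [AddCommGroup P] [Module R P] [AddCommGroup B] [Module R B]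
    [AddCommGroup B'] [Module R B']
    (π : P →ₗ[R] X) (d : B →ₗ[R] P) (d' : B' →ₗ[R] B) (hd : Function.Exact d π)
    (hd' : Function.Exact d' d) :
    (∀ φ : B →ₗ[R] N, φ ∘ₗ d' = 0 → ∃ ψ : P →ₗ[R] N, ψ ∘ₗ d = φ) ↔
    ∀ k : LinearMap.ker π →ₗ[R] N, ∃ h : P →ₗ[R] N, h ∘ₗ (LinearMap.ker π).subtype = k := by
  let q : B →ₗ[R] LinearMap.ker π := d.codRestrict _ fun x => hd.apply_apply_eq_zero x
  have hq : Function.Surjective q := fun y => by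
    obtain ⟨x, hx⟩ := (hd y).1 y.2
    exact ⟨x, Subtype.ext hx⟩
  constructor
  · intro H k
    obtain ⟨ψ, hψ⟩ := H (k ∘ₗ q) (LinearMap.ext fun x => by
      have : q (d' x) = 0 := Subtype.ext (hd'.apply_apply_eq_zero x)
      simp [this])
    refine ⟨ψ, LinearMap.ext fun y => ?_⟩
    obtain ⟨x, rfl⟩ := hq y
    exact LinearMap.congr_fun hψ x
  · intro H φ hφ
    obtain ⟨k, hk⟩ := exists_comp_eq_of_surjective q hq φ (fun x hx => by
      obtain ⟨y, rfl⟩ := (hd' x).1 (congrArg Subtype.val hx)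
      exact LinearMap.congr_fun hφ y)
    obtain ⟨h, hh⟩ := H k
    refine ⟨h, LinearMap.ext fun x => ?_⟩
    rw [← hk]
    exact LinearMap.congr_fun hh (q x)

/-- If homomorphisms extend along sequences ending in `M`, and along sequences ending in a
first syzygy of `coker g`, then they extend from `ker g` to the source of `g`. -/
lemma exists_extend_ker_of_syzygy {E M N Q : Type} [AddCommGroup E] [Module R E]
    [AddCommGroup M] [Module R M] [AddCommGroup N] [Module R N] [AddCommGroup Q] [Module R Q]
    [Module.Projective R Q] (g : E →ₗ[R] M) (π : Q →ₗ[R] M ⧸ LinearMap.range g)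
    (hπ : Function.Surjective π) (hM : HomExtends R M N)
    (hQ : HomExtends R (LinearMap.ker π) N) (k : LinearMap.ker g →ₗ[R] N) :
    ∃ h : E →ₗ[R] N, h ∘ₗ (LinearMap.ker g).subtype = k := by
  obtain ⟨u, hu⟩ := Module.projective_lifting_property (LinearMap.range g).mkQ π
    (Submodule.mkQ_surjective _)
  have hu' : ∀ q, (LinearMap.range g).mkQ (u q) = π q := fun q => LinearMap.congr_fun hu q
  have hur : ∀ q, π q = 0 ↔ u q ∈ LinearMap.range g := fun q => by
    rw [← hu', Submodule.mkQ_apply, Submodule.Quotient.mk_eq_zero]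
  let w : Q × E →ₗ[R] M := u.coprod g
  have hw : Function.Surjective w := fun m => by
    obtain ⟨q, hq⟩ := hπ ((LinearMap.range g).mkQ m)
    obtain ⟨e, he⟩ : m - u q ∈ LinearMap.range g := by
      rw [← Submodule.Quotient.mk_eq_zero, ← Submodule.mkQ_apply, map_sub, hu', hq, sub_self]
    exact ⟨(q, e), by simp [w, he]⟩
  let j : LinearMap.ker g →ₗ[R] LinearMap.ker w :=
    (LinearMap.inr R Q E ∘ₗ (LinearMap.ker g).subtype).codRestrict _ fun x => by simp [w]
  let r : LinearMap.ker w →ₗ[R] LinearMap.ker π :=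
    (LinearMap.fst R Q E ∘ₗ (LinearMap.ker w).subtype).codRestrict _ fun x => by
      refine (hur _).2 ⟨-x.1.2, ?_⟩
      have : u x.1.1 + g x.1.2 = 0 := x.2
      rw [map_neg]; exact (eq_neg_of_add_eq_zero_left this).symm
  obtain ⟨h₁, hh₁⟩ := hQ _ _ j r
    (fun x y hxy => Subtype.ext (congrArg (fun z : LinearMap.ker w => z.1.2) hxy))
    (fun x => by
      constructor
      · intro hx
        have h1 : x.1.1 = 0 := congrArg Subtype.val hx
        have h2 : u x.1.1 + g x.1.2 = 0 := x.2
        rw [h1, map_zero, zero_add] at h2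
        exact ⟨⟨x.1.2, h2⟩, Subtype.ext (Prod.ext h1.symm rfl)⟩
      · rintro ⟨y, rfl⟩
        rfl)
    (fun q => by
      obtain ⟨e, he⟩ := (hur _).1 q.2
      exact ⟨⟨(q, -e), by simp [w, he]⟩, rfl⟩) k
  obtain ⟨h₂, hh₂⟩ := hM _ _ (LinearMap.ker w).subtype w (Submodule.subtype_injective _)
    (LinearMap.exact_subtype_ker_map w) hw h₁
  refine ⟨h₂ ∘ₗ LinearMap.inr R Q E, LinearMap.ext fun x => ?_⟩
  rw [← hh₁, ← hh₂]
  rfl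

end HomExtension

section ExtComputation

variable {R : Type} [CommRing R]

lemma subsingleton_extM_succ_iff (M N : Type) [AddCommGroup M] [Module R M]
    [AddCommGroup N] [Module R N] (P : ProjectiveResolution (ModuleCat.of R M)) (n : ℕ) :
    Subsingleton (extM R M N (n + 1)) ↔
      ∀ φ : P.complex.X (n + 1) →ₗ[R] N, φ ∘ₗ (P.complex.d (n + 2) (n + 1)).hom = 0 →
        ∃ ψ : P.complex.X n →ₗ[R] N, ψ ∘ₗ (P.complex.d (n + 1) n).hom = φ := by
  have h1 : Subsingleton (extM R M N (n + 1)) ↔ Limits.IsZero (extM R M N (n + 1)) :=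
    ⟨fun _ => ModuleCat.isZero_of_subsingleton _, ModuleCat.subsingleton_of_isZero⟩
  rw [h1, extM, (P.isoExt (n + 1) (ModuleCat.of R N)).isZero_iff,
    ← HomologicalComplex.exactAt_iff_isZero_homology,
    HomologicalComplex.exactAt_iff' _ n (n + 1) (n + 2) (by simp) (by simp),
    ShortComplex.moduleCat_exact_iff]
  constructor
  · intro H φ hφ
    obtain ⟨ψ, hψ⟩ := H (ModuleCat.ofHom φ) (ModuleCat.hom_ext hφ)
    exact ⟨ModuleCat.Hom.hom ψ, congrArg ModuleCat.Hom.hom hψ⟩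
  · intro H φ hφ
    obtain ⟨ψ, hψ⟩ := H (ModuleCat.Hom.hom φ) (congrArg ModuleCat.Hom.hom hφ)
    exact ⟨ModuleCat.ofHom ψ, ModuleCat.hom_ext hψ⟩

lemma exact_d_succ {M : Type} [AddCommGroup M] [Module R M]
    (P : ProjectiveResolution (ModuleCat.of R M)) (n : ℕ) :
    Function.Exact (P.complex.d (n + 2) (n + 1)).hom (P.complex.d (n + 1) n).hom :=
  (ShortComplex.ShortExact.moduleCat_exact_iff_function_exact _).1 (P.exact_succ n)

/-- The augmentation of a projective resolution, as a linear map. -/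
noncomputable def augmentation {M : Type} [AddCommGroup M] [Module R M]
    (P : ProjectiveResolution (ModuleCat.of R M)) : P.complex.X 0 →ₗ[R] M :=
  (P.π.f 0).hom

lemma augmentation_surjective {M : Type} [AddCommGroup M] [Module R M]
    (P : ProjectiveResolution (ModuleCat.of R M)) : Function.Surjective (augmentation P) :=
  (ModuleCat.epi_iff_surjective (P.π.f 0)).1 inferInstance

lemma exact_d_augmentation {M : Type} [AddCommGroup M] [Module R M]
    (P : ProjectiveResolution (ModuleCat.of R M)) :
    Function.Exact (P.complex.d 1 0).hom (augmentation P) :=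
  (ShortComplex.ShortExact.moduleCat_exact_iff_function_exact _).1 P.exact₀

instance {M : ModuleCat.{0} R} (P : ProjectiveResolution M) (n : ℕ) :
    Module.Projective R (P.complex.X n) :=
  (IsProjective.iff_projective _).2 (P.projective n)

lemma subsingleton_extM_one_iff {M N : Type} [AddCommGroup M] [Module R M]
    [AddCommGroup N] [Module R N] :
    Subsingleton (extM R M N 1) ↔ HomExtends R M N := by
  let P : ProjectiveResolution (ModuleCat.of R M) := ProjectiveResolution.of _
  rw [subsingleton_extM_succ_iff M N P 0,
    extends_ker_iff_of_exact (augmentation P) _ _ (exact_d_augmentation P) (exact_d_succ P 0)]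
  exact ⟨HomExtends.of_projective _ (augmentation_surjective P), fun H k =>
    H _ _ (LinearMap.ker (augmentation P)).subtype _ (Submodule.subtype_injective _)
      (LinearMap.exact_subtype_ker_map _) (augmentation_surjective P) k⟩

/-- Dimension shifting. -/
lemma homExtends_ker_augmentation {M N : Type} [AddCommGroup M] [Module R M]
    [AddCommGroup N] [Module R N] (P : ProjectiveResolution (ModuleCat.of R M))
    (H : Subsingleton (extM R M N 2)) :
    HomExtends R (LinearMap.ker (augmentation P)) N := by
  rw [subsingleton_extM_succ_iff M N P 1] at H
  let q : P.complex.X 1 →ₗ[R] LinearMap.ker (augmentation P) :=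
    (P.complex.d 1 0).hom.codRestrict _ (exact_d_augmentation P).apply_apply_eq_zero
  have hq : Function.Surjective q := fun y => by
    obtain ⟨x, hx⟩ := (exact_d_augmentation P y).1 y.2
    exact ⟨x, Subtype.ext hx⟩
  have hdq : Function.Exact (P.complex.d 2 1).hom q := fun x =>
    Subtype.ext_iff.trans (exact_d_succ P 0 x)
  exact HomExtends.of_projective q hq
    ((extends_ker_iff_of_exact q _ _ hdq (exact_d_succ P 1)).1 H)

end ExtComputation

section GVIdeals

variable {R : Type} [CommRing R]

lemma IsGVIdeal.eq_zero_of_mul_eq_zero {J : Ideal R} (hJ : IsGVIdeal R J) {r : R}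
    (h : ∀ j ∈ J, r * j = 0) : r = 0 :=
  hJ.2.1 (LinearMap.ext fun j => by simp [h j j.2])

lemma IsGVIdeal.exists_mul_eq {J : Ideal R} (hJ : IsGVIdeal R J) (φ : J →ₗ[R] R) :
    ∃ r : R, ∀ j : J, r * j = φ j := by
  obtain ⟨r, hr⟩ := hJ.2.2 φ
  exact ⟨r, fun j => LinearMap.congr_fun hr j⟩

lemma isGVIdeal_top : IsGVIdeal R (⊤ : Ideal R) := by
  refine ⟨⟨{1}, by simp⟩, fun r s h => ?_, fun φ => ⟨φ ⟨1, trivial⟩, LinearMap.ext fun j => ?_⟩⟩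
  · simpa using LinearMap.congr_fun h ⟨1, trivial⟩
  · have : j = j.1 • (⟨1, trivial⟩ : (⊤ : Ideal R)) := Subtype.ext (by simp)
    conv_rhs => rw [this, map_smul]
    simp [mul_comm]

lemma IsGVIdeal.mul {J K : Ideal R} (hJ : IsGVIdeal R J) (hK : IsGVIdeal R K) :
    IsGVIdeal R (J * K) := by
  refine ⟨hJ.1.mul hK.1, fun r s h => ?_, fun φ => ?_⟩
  · rw [← sub_eq_zero]
    refine hJ.eq_zero_of_mul_eq_zero fun j hj => hK.eq_zero_of_mul_eq_zero fun k hk => ?_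
    have : r * (j * k) = s * (j * k) :=
      LinearMap.congr_fun h ⟨j * k, Ideal.mul_mem_mul hj hk⟩
    linear_combination this
  · let m : J → K →ₗ[R] (J * K : Ideal R) := fun j =>
      (LinearMap.mulLeft R j.1 ∘ₗ K.subtype).codRestrict _ fun k => Ideal.mul_mem_mul j.2 k.2
    have hm : ∀ j k, (m j k : R) = j * k := fun j k => rfl
    choose a ha using fun j => hK.exists_mul_eq (φ ∘ₗ m j)
    let ψ : J →ₗ[R] R :=
      { toFun := a
        map_add' := fun x y => by
          rw [← sub_eq_zero]
          refine hK.eq_zero_of_mul_eq_zero fun k hk => ?_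
          have h1 := ha (x + y) ⟨k, hk⟩
          have h2 : m (x + y) ⟨k, hk⟩ = m x ⟨k, hk⟩ + m y ⟨k, hk⟩ :=
            Subtype.ext (add_mul x.1 y.1 k)
          rw [LinearMap.comp_apply, h2, map_add, ← LinearMap.comp_apply, ← LinearMap.comp_apply,
            ← ha x, ← ha y] at h1
          linear_combination h1
        map_smul' := fun r x => by
          rw [← sub_eq_zero]
          refine hK.eq_zero_of_mul_eq_zero fun k hk => ?_
          have h1 := ha (r • x) ⟨k, hk⟩
          have h2 : m (r • x) ⟨k, hk⟩ = r • m x ⟨k, hk⟩ := Subtype.ext (mul_assoc r x.1 k)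
          rw [LinearMap.comp_apply, h2, map_smul, ← LinearMap.comp_apply, ← ha x] at h1
          simp only [smul_eq_mul, RingHom.id_apply] at h1 ⊢
          linear_combination h1 }
    obtain ⟨r, hr⟩ := hJ.exists_mul_eq ψ
    refine ⟨r, LinearMap.ext fun ⟨x, hx⟩ => ?_⟩
    change r * x = φ ⟨x, hx⟩
    induction hx using Submodule.mul_induction_on' with
    | mem_mul_mem j hj k hk =>
      have h1 : a ⟨j, hj⟩ * k = φ ⟨j * k, _⟩ := ha ⟨j, hj⟩ ⟨k, hk⟩
      rw [← h1, ← mul_assoc]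
      exact congrArg (· * k) (hr ⟨j, hj⟩)
    | add x hx y hy hx' hy' =>
      rw [mul_add, hx', hy', ← map_add]
      rfl

/-- Maximal `w`-ideals are prime. -/
lemma IsMaxWIdeal.isPrime {P : Ideal R} (hP : IsMaxWIdeal R P) : P.IsPrime := by
  refine ⟨hP.2.1, fun {a b} hab => or_iff_not_imp_left.2 fun ha => ?_⟩
  let I : Ideal R := Submodule.comap (LinearMap.mulRight R a) P
  have hmem : ∀ x, x ∈ I ↔ x * a ∈ P := fun x => Iff.rfl
  have hI : I = P := by
    refine hP.2.2 I (fun x ⟨J, hJ, hx⟩ => hP.1 (x * a) ⟨J, hJ, fun j hj => ?_⟩) ?_ ?_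
    · rw [← mul_assoc]; exact hx j hj
    · rw [Ne, Ideal.eq_top_iff_one, hmem, one_mul]; exact ha
    · exact fun x hx => (hmem x).2 (P.mul_mem_right a hx)
  rw [← hI, hmem, mul_comm]
  exact hab

/-- An ideal contained in no maximal `w`-ideal contains a GV-ideal. -/
lemma exists_isGVIdeal_le {I : Ideal R} (hI : ∀ P : Ideal R, IsMaxWIdeal R P → ¬ I ≤ P) :
    ∃ J, IsGVIdeal R J ∧ J ≤ I := by
  by_contra hc
  obtain ⟨P, hIP, hP⟩ := zorn_le_nonempty₀ {K : Ideal R | ¬ ∃ J, IsGVIdeal R J ∧ J ≤ K}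
    (fun c hc hchain y hy => ⟨sSup c, fun ⟨J, hJ, hle⟩ => by
      obtain ⟨K, hK, hJK⟩ := (CompleteLattice.isCompactElement_iff_le_of_directed_sSup_le _ J).1
        ((Submodule.fg_iff_compact J).1 hJ.1) c ⟨y, hy⟩ hchain.directedOn hle
      exact hc hK ⟨J, hJ, hJK⟩, fun _ => le_sSup⟩) I hc
  refine hI P ⟨fun x ⟨J, hJ, hx⟩ => ?_, ?_, fun K hK hK' hPK => ?_⟩ hIP
  · by_contra hxP
    have hlt : P < P ⊔ Ideal.span {x} := lt_of_le_of_ne le_sup_left fun h =>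
      hxP (h ▸ (le_sup_right : _ ≤ P ⊔ Ideal.span {x}) (Ideal.mem_span_singleton_self x))
    obtain ⟨K, hK, hle⟩ := not_not.1 (hP.not_prop_of_gt hlt)
    refine hP.prop ⟨J * K, hJ.mul hK, Ideal.mul_le.2 fun j hj k hk => ?_⟩
    obtain ⟨p, hp, y, hy, rfl⟩ := Submodule.mem_sup.1 (hle hk)
    obtain ⟨r, rfl⟩ := Ideal.mem_span_singleton'.1 hy
    rw [mul_add, mul_left_comm]
    exact P.add_mem (P.mul_mem_left _ hp) (P.mul_mem_left _ (hx j hj))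
  · rintro rfl
    exact hP.prop ⟨⊤, isGVIdeal_top, le_rfl⟩
  · refine hP.eq_of_ge ?_ hPK
    rintro ⟨J, hJ, hle⟩
    exact hK' ((Ideal.eq_top_iff_one _).2 (hK 1 ⟨J, hJ, fun j hj => by simpa using hle hj⟩))

/-- An element which locally at all maximal `w`-ideals lies in a submodule is multiplied into
it by some GV-ideal. -/
lemma exists_isGVIdeal_smul_mem {M : Type*} [AddCommGroup M] [Module R M] (S : Submodule R M)
    (x : M) (h : ∀ P : Ideal R, IsMaxWIdeal R P → ∃ s ∉ P, s • x ∈ S) :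
    ∃ J, IsGVIdeal R J ∧ ∀ j ∈ J, j • x ∈ S := by
  obtain ⟨J, hJ, hle⟩ := exists_isGVIdeal_le (I := S.comap (LinearMap.toSpanSingleton R M x))
    fun P hP hle => by
      obtain ⟨s, hs, hsx⟩ := h P hP
      exact hs (hle hsx)
  exact ⟨J, hJ, fun j hj => hle hj⟩

end GVIdeals

section WShortExact

variable {R : Type} [CommRing R] {L E M : Type} [AddCommGroup L] [Module R L]
  [AddCommGroup E] [Module R E] [AddCommGroup M] [Module R M] {f : L →ₗ[R] E} {g : E →ₗ[R] M}

lemma locMap_mkLinearMap (S : Submonoid R) (f : L →ₗ[R] E) (x : L) :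
    locMap R S f (LocalizedModule.mkLinearMap S L x) = LocalizedModule.mkLinearMap S E (f x) :=
  IsLocalizedModule.map_apply ..

lemma exists_smul_eq_of_mkLinearMap_eq {S : Submonoid R} {x y : M}
    (h : LocalizedModule.mkLinearMap S M x = LocalizedModule.mkLinearMap S M y) :
    ∃ s ∈ S, s • x = s • y := by
  obtain ⟨c, hc⟩ := (IsLocalizedModule.eq_iff_exists S (LocalizedModule.mkLinearMap S M)).1 h
  exact ⟨c, c.2, hc⟩

lemma exists_smul_mem_range {S : Submonoid R} {f : L →ₗ[R] E} {x : E}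
    (h : LocalizedModule.mkLinearMap S E x ∈ Set.range (locMap R S f)) :
    ∃ s ∈ S, s • x ∈ LinearMap.range f := by
  obtain ⟨y, hy⟩ := h
  obtain ⟨⟨l, s⟩, hl⟩ := IsLocalizedModule.surj S (LocalizedModule.mkLinearMap S L) y
  have h1 : LocalizedModule.mkLinearMap S E (s • x) =
      LocalizedModule.mkLinearMap S E (f l) := by
    rw [← locMap_mkLinearMap, ← hl, Submonoid.smul_def, Submonoid.smul_def, map_smul, map_smul, hy]
  obtain ⟨t, ht, h2⟩ := exists_smul_eq_of_mkLinearMap_eq h1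
  exact ⟨t * s, S.mul_mem ht s.2, t • l, by rw [map_smul, ← h2, mul_smul]; rfl⟩

lemma IsWShortExact.exists_smul_eq_zero (h : IsWShortExact R f g) {x : L} (hx : f x = 0) :
    ∃ J, IsGVIdeal R J ∧ ∀ j ∈ J, j • x = 0 := by
  refine exists_isGVIdeal_smul_mem ⊥ x fun P hP => ?_
  have := hP.isPrime
  obtain ⟨s, hs, h1⟩ := exists_smul_eq_of_mkLinearMap_eq (S := P.primeCompl) (x := x) (y := 0)
    ((h P hP).1 (by rw [locMap_mkLinearMap, hx, map_zero, map_zero, map_zero]))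
  exact ⟨s, hs, by simpa using h1⟩

lemma IsWShortExact.exists_smul_mem_range (h : IsWShortExact R f g) {x : E} (hx : g x = 0) :
    ∃ J, IsGVIdeal R J ∧ ∀ j ∈ J, j • x ∈ LinearMap.range f := by
  refine exists_isGVIdeal_smul_mem _ x fun P hP => ?_
  have := hP.isPrime
  exact _root_.exists_smul_mem_range (S := P.primeCompl)
    (((h P hP).2.1 _).1 (by rw [locMap_mkLinearMap, hx, map_zero]))

lemma IsWShortExact.exists_smul_comp_eq_zero (h : IsWShortExact R f g) (x : L) :
    ∃ J, IsGVIdeal R J ∧ ∀ j ∈ J, j • g (f x) = 0 := by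
  refine exists_isGVIdeal_smul_mem ⊥ _ fun P hP => ?_
  have := hP.isPrime
  obtain ⟨s, hs, h1⟩ := exists_smul_eq_of_mkLinearMap_eq (S := P.primeCompl)
    (x := g (f x)) (y := 0) (by
      rw [← locMap_mkLinearMap, ← locMap_mkLinearMap, (h P hP).2.1.apply_apply_eq_zero, map_zero])
  exact ⟨s, hs, by simpa using h1⟩

lemma IsWShortExact.exists_smul_mem_range_right (h : IsWShortExact R f g) (x : M) :
    ∃ J, IsGVIdeal R J ∧ ∀ j ∈ J, j • x ∈ LinearMap.range g := by
  refine exists_isGVIdeal_smul_mem _ x fun P hP => ?_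
  have := hP.isPrime
  exact _root_.exists_smul_mem_range (S := P.primeCompl) ((h P hP).2.2 _)

lemma IsWShortExact.of_exact (hf : Function.Injective f) (hfg : Function.Exact f g)
    (hg : Function.Surjective g) : IsWShortExact R f g := fun P _ _ =>
  ⟨IsLocalizedModule.map_injective P.primeCompl _ _ f hf,
    IsLocalizedModule.map_exact P.primeCompl _ _ _ f g hfg,
    IsLocalizedModule.map_surjective P.primeCompl _ _ g hg⟩

end WShortExact

section DaggerClass

variable {R : Type} [CommRing R] {N : Type} [AddCommGroup N] [Module R N]

lemma IsGVTorsionFree.apply_eq_zero (hN : IsGVTorsionFree R N) {A : Type*} [AddCommGroup A]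
    [Module R A] (h : A →ₗ[R] N) {x : A}
    (hx : ∃ J, IsGVIdeal R J ∧ ∀ j ∈ J, j • x ∈ LinearMap.ker h) : h x = 0 := by
  obtain ⟨J, hJ, hx⟩ := hx
  exact hN _ ⟨J, hJ, fun j hj => by rw [← map_smul]; exact hx j hj⟩

lemma IsGVTorsion.isWProjective {T : Type} [AddCommGroup T] [Module R T]
    (hT : IsGVTorsion R T) : IsWProjective R T := by
  intro N _ _ _ _ L _ _ ι hι
  have htop : torGV R T = ⊤ := eq_top_iff.2 fun x _ => Submodule.subset_span (hT x)
  have : Subsingleton (T ⧸ torGV R T) := Submodule.Quotient.subsingleton_iff.2 htop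
  have : Subsingleton L := subsingleton_of_forall_eq 0 fun x => hι.1.1 x (by
    obtain ⟨J, hJ, h⟩ := hι.2.2 (Submodule.Quotient.mk x)
    refine ⟨J, hJ, fun j hj => ?_⟩
    have h1 := h j hj
    rw [← Submodule.Quotient.mk_smul, Submodule.Quotient.mk_eq_zero] at h1
    obtain ⟨y, hy⟩ := h1
    rw [← hy, Subsingleton.elim y 0, map_zero])
  have : Subsingleton (extM R L N 1) := subsingleton_extM_one_iff.2 HomExtends.of_subsingleton
  exact fun x => ⟨⊤, isGVIdeal_top, fun j _ => Subsingleton.elim _ _⟩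

lemma isGVTorsion_quotient {M : Type} [AddCommGroup M] [Module R M] {S : Submodule R M}
    (h : ∀ x : M, ∃ J, IsGVIdeal R J ∧ ∀ j ∈ J, j • x ∈ S) : IsGVTorsion R (M ⧸ S) := by
  intro x
  obtain ⟨x, rfl⟩ := Submodule.Quotient.mk_surjective _ x
  obtain ⟨J, hJ, hx⟩ := h x
  exact ⟨J, hJ, fun j hj => by
    rw [← Submodule.Quotient.mk_smul, Submodule.Quotient.mk_eq_zero]; exact hx j hj⟩

/-- Homomorphisms to a member of `P_w^{†∞}` extend along maps whose kernel and cokernel are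
GV-torsion. -/
lemma MemPwDaggerInfty.exists_extend (hN : MemPwDaggerInfty R N) {A B : Type} [AddCommGroup A]
    [Module R A] [AddCommGroup B] [Module R B] (f : A →ₗ[R] B)
    (hker : ∀ x, f x = 0 → ∃ J, IsGVIdeal R J ∧ ∀ j ∈ J, j • x = 0)
    (hcoker : ∀ x, ∃ J, IsGVIdeal R J ∧ ∀ j ∈ J, j • x ∈ LinearMap.range f)
    (k : A →ₗ[R] N) : ∃ h : B →ₗ[R] N, h ∘ₗ f = k := by
  obtain ⟨k', hk'⟩ := exists_comp_eq_of_surjective f.rangeRestrict f.surjective_rangeRestrict k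
    (fun x hx => hN.1.apply_eq_zero k (by
      obtain ⟨J, hJ, h⟩ := hker x (congrArg Subtype.val hx)
      exact ⟨J, hJ, fun j hj => by rw [h j hj]; exact zero_mem _⟩))
  have hT : HomExtends R (B ⧸ LinearMap.range f) N := subsingleton_extM_one_iff.1
    (hN.2 _ (isGVTorsion_quotient hcoker).isWProjective 1 le_rfl)
  obtain ⟨h, hh⟩ := hT _ _ (LinearMap.range f).subtype (LinearMap.range f).mkQ
    (Submodule.subtype_injective _) (LinearMap.exact_subtype_mkQ _)
    (Submodule.mkQ_surjective _) k'
  exact ⟨h, by rw [← hk', ← hh]; rfl⟩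

/-- Homomorphisms `ker g → N` extend to the source of `g` when the cokernel of `g` is
GV-torsion and `Ext^1_R(M, N) = 0`. -/
lemma MemPwDaggerInfty.exists_extend_ker (hN : MemPwDaggerInfty R N) {E M : Type}
    [AddCommGroup E] [Module R E] [AddCommGroup M] [Module R M] (g : E →ₗ[R] M)
    (hcoker : ∀ x, ∃ J, IsGVIdeal R J ∧ ∀ j ∈ J, j • x ∈ LinearMap.range g)
    (hM : HomExtends R M N) (k : LinearMap.ker g →ₗ[R] N) :
    ∃ h : E →ₗ[R] N, h ∘ₗ (LinearMap.ker g).subtype = k := by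
  let P : ProjectiveResolution (ModuleCat.of R (M ⧸ LinearMap.range g)) :=
    ProjectiveResolution.of _
  exact exists_extend_ker_of_syzygy g (augmentation P) (augmentation_surjective P) hM
    (homExtends_ker_augmentation P
      (hN.2 _ (isGVTorsion_quotient hcoker).isWProjective 2 one_le_two)) k

lemma IsWShortExact.exact_lcomp {L E M : Type} [AddCommGroup L] [Module R L] [AddCommGroup E]
    [Module R E] [AddCommGroup M] [Module R M] {f : L →ₗ[R] E} {g : E →ₗ[R] M}
    (hfg : IsWShortExact R f g) (hN : MemPwDaggerInfty R N) (hM : HomExtends R M N) :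
    Function.Injective (LinearMap.lcomp R N g) ∧
      Function.Exact ⇑(LinearMap.lcomp R N g) ⇑(LinearMap.lcomp R N f) ∧
      Function.Surjective (LinearMap.lcomp R N f) := by
  refine ⟨(injective_iff_map_eq_zero _).2 fun h hh => LinearMap.ext fun x => ?_, fun h => ?_,
    fun k => ?_⟩
  · refine hN.1.apply_eq_zero h ?_
    obtain ⟨J, hJ, hx⟩ := hfg.exists_smul_mem_range_right x
    refine ⟨J, hJ, fun j hj => ?_⟩
    obtain ⟨y, hy⟩ := hx j hj
    rw [← hy]
    exact LinearMap.congr_fun hh y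
  · constructor
    · intro hh
      obtain ⟨h', hh'⟩ := exists_comp_eq_of_surjective g.rangeRestrict
        g.surjective_rangeRestrict h (fun x hx => hN.1.apply_eq_zero h (by
          obtain ⟨J, hJ, hx⟩ := hfg.exists_smul_mem_range (congrArg Subtype.val hx)
          refine ⟨J, hJ, fun j hj => ?_⟩
          obtain ⟨y, hy⟩ := hx j hj
          rw [← hy]
          exact LinearMap.congr_fun hh y))
      obtain ⟨h'', hh''⟩ := hN.exists_extend (LinearMap.range g).subtype
        (fun x hx => ⟨⊤, isGVIdeal_top, fun j _ => by
          rw [show x = 0 from Subtype.ext hx, smul_zero]⟩)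
        (fun x => by rw [Submodule.range_subtype]; exact hfg.exists_smul_mem_range_right x) h'
      exact ⟨h'', by rw [← hh', ← hh'']; rfl⟩
    · rintro ⟨h, rfl⟩
      refine LinearMap.ext fun x => hN.1.apply_eq_zero (h ∘ₗ g ∘ₗ f) ?_
      obtain ⟨J, hJ, hx⟩ := hfg.exists_smul_comp_eq_zero x
      exact ⟨J, hJ, fun j hj => by
        simp only [LinearMap.mem_ker, LinearMap.comp_apply, map_smul, ← map_smul h, hx j hj,
          map_zero]⟩
  · let f' : LinearMap.ker (g ∘ₗ f) →ₗ[R] LinearMap.ker g :=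
      (f ∘ₗ (LinearMap.ker (g ∘ₗ f)).subtype).codRestrict _ fun x => x.2
    obtain ⟨k', hk'⟩ := hN.exists_extend f'
      (fun x hx => by
        obtain ⟨J, hJ, h⟩ := hfg.exists_smul_eq_zero (congrArg Subtype.val hx)
        exact ⟨J, hJ, fun j hj => Subtype.ext (h j hj)⟩)
      (fun x => by
        obtain ⟨J, hJ, h⟩ := hfg.exists_smul_mem_range x.2
        refine ⟨J, hJ, fun j hj => ?_⟩
        obtain ⟨y, hy⟩ := h j hj
        refine ⟨⟨y, ?_⟩, Subtype.ext hy⟩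
        change g (f y) = 0
        rw [hy, map_smul, x.2, smul_zero])
      (k ∘ₗ (LinearMap.ker (g ∘ₗ f)).subtype)
    obtain ⟨h, hh⟩ := hN.exists_extend_ker g hfg.exists_smul_mem_range_right hM k'
    refine ⟨h, LinearMap.ext fun x => sub_eq_zero.1 (hN.1.apply_eq_zero (h ∘ₗ f - k) ?_)⟩
    obtain ⟨J, hJ, hx⟩ := hfg.exists_smul_comp_eq_zero x
    refine ⟨J, hJ, fun j hj => ?_⟩
    have hmem : j • x ∈ LinearMap.ker (g ∘ₗ f) := by
      rw [LinearMap.mem_ker, map_smul]; exact hx j hj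
    have h1 : h (f (j • x)) = k' (f' ⟨j • x, hmem⟩) := LinearMap.congr_fun hh (f' ⟨j • x, hmem⟩)
    have h2 : k' (f' ⟨j • x, hmem⟩) = k (j • x) := LinearMap.congr_fun hk' ⟨j • x, hmem⟩
    exact sub_eq_zero.2 (h1.trans h2)

end DaggerClass

/-- `M` is weak `w`-projective iff for every `w`-exact sequence
`0 → L → E → M → 0` and every `N ∈ P_w^{†∞}`, the induced sequence
`0 → Hom_R(M, N) → Hom_R(E, N) → Hom_R(L, N) → 0` is exact. -/
theorem weakWProjective_iff_hom_wExact (R : Type) [CommRing R]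
    (M : Type) [AddCommGroup M] [Module R M] :
    IsWeakWProjective R M ↔
      ∀ (L E : Type) [AddCommGroup L] [Module R L] [AddCommGroup E] [Module R E]
        (f : L →ₗ[R] E) (g : E →ₗ[R] M), IsWShortExact R f g →
        ∀ (N : Type) [AddCommGroup N] [Module R N], MemPwDaggerInfty R N →
          Function.Injective (LinearMap.lcomp R N g) ∧
          Function.Exact ⇑(LinearMap.lcomp R N g) ⇑(LinearMap.lcomp R N f) ∧
          Function.Surjective (LinearMap.lcomp R N f) := by
  refine ⟨fun hM L E _ _ _ _ f g hfg N _ _ hN =>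
    hfg.exact_lcomp hN (subsingleton_extM_one_iff.1 (hM N hN)), fun H N _ _ hN => ?_⟩
  exact subsingleton_extM_one_iff.2 fun A E _ _ _ _ i p hi hip hp k =>
    (H A E i p (IsWShortExact.of_exact hi hip hp) N hN).2.2 k
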